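/- Under the feature-label strategy, if for every collective c the classifier m is ε-suboptimal on X under the mixture P, P_0^X(X_c*) ≤ ξ_c, and P_j^X(X_c*) ≤ ξ for all j ≠ c, then the mass-weighted global success satisfies S_w := (1/ᾱ)Σ_{c=1}^M α_c S_c(α_c) ≥ 1 − ((1 − ᾱ)/ᾱ)·Σ_{c=1}^M ξ_c·(Δ_c + 2ε)/(α_c(1 − 2ε)) − ξ·((1 + 2ε)/(1 − 2ε))·(1/ᾱ)·Σ_{c=1}^M (ᾱ − α_c − β_c)/α_c. -/

import Mathlib

open Finset

/-- A distribution on a finite set: nonnegative and sums to 1. -/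
def IsDist {S : Type*} [Fintype S] (f : S → ℝ) : Prop :=
  (∀ s, 0 ≤ f s) ∧ ∑ s, f s = 1

/-- X-marginal of a distribution on `X × Y`. -/
noncomputable def margX {X Y : Type*} [Fintype Y] (μ : X × Y → ℝ) (x : X) : ℝ :=
  ∑ y, μ (x, y)

/-- Y-marginal of a distribution on `X × Y`. -/
noncomputable def margY {X Y : Type*} [Fintype X] (μ : X × Y → ℝ) (y : Y) : ℝ :=
  ∑ x, μ (x, y)

/-- Conditional probability of label `y` given features `x`. -/
noncomputable def condY {X Y : Type*} [Fintype Y] (μ : X × Y → ℝ) (x : X) (y : Y) : ℝ :=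
  μ (x, y) / margX μ x

/-- Pushforward of a distribution on a finite set under a map. -/
noncomputable def pushforward {Z : Type*} [Fintype Z] [DecidableEq Z]
    (μ : Z → ℝ) (h : Z → Z) (z : Z) : ℝ :=
  ∑ w, if h w = z then μ w else 0

/-- A classifier `m` is `ε`-suboptimal on `X'` under `P`: for every `x ∈ X'` there is a
distribution `q` on labels at total-variation distance at most `ε` from `P(·∣x)` such that
`m x` maximizes `q`. -/
def Suboptimal {X Y : Type*} [Fintype Y] (m : X → Y) (ε : ℝ) (X' : Set X)
    (P : X × Y → ℝ) : Prop :=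
  ∀ x ∈ X', ∃ q : Y → ℝ, (∀ y, 0 ≤ q y) ∧ (∑ y, q y = 1) ∧
    (1 / 2) * (∑ y, |q y - condY P x y|) ≤ ε ∧ ∀ y, q y ≤ q (m x)

/-- Feature mass at `x` of the pushforward of `P0` under `g`. -/
noncomputable def featureMass {X Y : Type*} [Fintype X] [Fintype Y] [DecidableEq X]
    (P0 : X × Y → ℝ) (g : X → X) (x : X) : ℝ :=
  ∑ w, if g w = x then margX P0 w else 0

section

variable {X Y : Type*} [Fintype Y]

lemma featureMass_nonneg [Fintype X] [DecidableEq X] {P0 : X × Y → ℝ} (hpos : ∀ x, 0 ≤ margX P0 x)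
    (g : X → X) (x : X) :
    0 ≤ featureMass P0 g x :=
  Finset.sum_nonneg fun w _ => by split_ifs <;> simp [hpos]

lemma pushforward_featureLabel [Fintype X] [DecidableEq X] [DecidableEq Y]
    (P0 : X × Y → ℝ) (g : X → X) (t : Y) (x : X) (y : Y) :
    pushforward P0 (fun w => (g w.1, t)) (x, y) = if t = y then featureMass P0 g x else 0 := by
  unfold pushforward featureMass margX
  rw [Fintype.sum_prod_type]
  by_cases h : t = y
  · simp only [h, Prod.mk.injEq, and_true, if_true]
    refine Finset.sum_congr rfl fun w _ => ?_
    split_ifs <;> simp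
  · simp [h]

lemma margX_pushforward_featureLabel [Fintype X] [DecidableEq X] [DecidableEq Y]
    (P0 : X × Y → ℝ) (g : X → X) (t : Y) (x : X) :
    margX (pushforward P0 (fun w => (g w.1, t))) x = featureMass P0 g x := by
  simp [margX, pushforward_featureLabel]

/-- The mass that `g` sends to features satisfying `p`, computed on the image of `g`. -/
lemma sum_featureMass_filter_image [Fintype X] [DecidableEq X]
    (P0 : X × Y → ℝ) (g : X → X) (p : X → Prop) [DecidablePred p] :
    ∑ x ∈ (Finset.univ.image g).filter p, featureMass P0 g x =
      ∑ w, if p (g w) then margX P0 w else 0 := by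
  unfold featureMass
  rw [Finset.sum_comm]
  refine Finset.sum_congr rfl fun w _ => ?_
  rw [Finset.sum_ite_eq]
  simp

/-- A maximizer of a distribution `ε`-close to `P(·∣x)` loses at most `2ε` against any label. -/
lemma Suboptimal.sub_le {m : X → Y} {ε : ℝ} {X' : Set X} {P : X × Y → ℝ}
    (h : Suboptimal m ε X' P) {x : X} (hx : x ∈ X') (hpos : 0 < margX P x) (y : Y) :
    P (x, y) - P (x, m x) ≤ 2 * ε * margX P x := by
  classical
  obtain ⟨q, -, -, hq, hmax⟩ := h x hx
  by_cases hy : y = m x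
  · have h0 : 0 ≤ ∑ y, |q y - condY P x y| := Finset.sum_nonneg fun _ _ => abs_nonneg _
    rw [hy, sub_self]
    exact mul_nonneg (by linarith) hpos.le
  · have hpair : |q y - condY P x y| + |q (m x) - condY P x (m x)|
        ≤ ∑ y, |q y - condY P x y| := by
      rw [← Finset.sum_pair (f := fun y => |q y - condY P x y|) hy]
      exact Finset.sum_le_sum_of_subset_of_nonneg (Finset.subset_univ _)
        fun _ _ _ => abs_nonneg _
    have h1 := neg_abs_le (q y - condY P x y)
    have h2 := le_abs_self (q (m x) - condY P x (m x))
    have h3 := hmax y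
    have h4 : condY P x y - condY P x (m x) ≤ 2 * ε := by linarith
    rwa [condY, condY, ← sub_div, div_le_iff₀ hpos] at h4

end

/-- Mass-weighted global success lower bound under the feature-label
strategy (Corollary 1, second bound). -/
theorem stmt5 {X Y : Type*} [Fintype X] [Fintype Y] [DecidableEq X] [DecidableEq Y]
    [Nonempty X] [Nonempty Y]
    (hY : 2 ≤ Fintype.card Y)
    (P0 : X × Y → ℝ) (hP0 : IsDist P0) (hpos : ∀ x, 0 < margX P0 x)
    (M : ℕ) (hM : 1 ≤ M)
    (α : Fin M → ℝ) (hα : ∀ c, 0 < α c) (htot : ∑ i, α i ≤ 1)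
    (g : Fin M → X → X) (ystar : Fin M → Y)
    (P : X × Y → ℝ)
    (hP : P = fun z => (1 - ∑ i, α i) * P0 z +
      ∑ j, α j * pushforward P0 (fun w => (g j w.1, ystar j)) z)
    (ε : ℝ) (hε0 : 0 ≤ ε) (hε : ε < 1 / 2)
    (m : X → Y) (hsub : Suboptimal m ε Set.univ P)
    (ξc : Fin M → ℝ) (ξ : ℝ)
    (hξc : ∀ c, ∑ x' ∈ Finset.univ.image (g c), margX P0 x' ≤ ξc c)
    (hξ : ∀ c, ∀ j, j ≠ c →
      ∑ x' ∈ Finset.univ.image (g c),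
        margX (pushforward P0 (fun w => (g j w.1, ystar j))) x' ≤ ξ)
    (Δ : Fin M → ℝ)
    (hΔ : ∀ c, Δ c = (Finset.univ.image (g c)).sup'
      (Finset.image_nonempty.mpr Finset.univ_nonempty)
      (fun x => (Finset.univ.sup' Finset.univ_nonempty (fun y => condY P0 x y))
        - condY P0 x (ystar c)))
    (β : Fin M → ℝ)
    (hβ : ∀ c, β c = ∑ j ∈ Finset.univ.filter (fun j => j ≠ c ∧ ystar j = ystar c), α j) :
    1 - ((1 - ∑ i, α i) / ∑ i, α i)
        * (∑ c, ξc c * ((Δ c + 2 * ε) / (α c * (1 - 2 * ε))))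
      - ξ * ((1 + 2 * ε) / (1 - 2 * ε)) * (1 / ∑ i, α i)
        * (∑ c, (∑ i, α i - α c - β c) / α c)
    ≤ (1 / ∑ i, α i) * ∑ c, α c *
        ∑ x, margX P0 x * (if m (g c x) = ystar c then (1 : ℝ) else 0) := by
  have hP0nn : ∀ x, 0 ≤ margX P0 x := fun x => (hpos x).le
  have hsum1 : ∑ x, margX P0 x = 1 := by
    rw [← hP0.2, Fintype.sum_prod_type]; rfl
  set A := ∑ i, α i with hA
  set R : Fin M → X → ℝ := fun j x => featureMass P0 (g j) x with hR
  have hRnn : ∀ j x, 0 ≤ R j x := fun j x => featureMass_nonneg hP0nn (g j) x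
  have hApos : 0 < A := Finset.sum_pos (fun c _ => hα c) ⟨⟨0, hM⟩, Finset.mem_univ _⟩
  have hK : 0 < 1 - 2 * ε := by linarith
  have hα1 : ∀ c, α c ≤ 1 := fun c =>
    (Finset.single_le_sum (fun i _ => (hα i).le) (Finset.mem_univ c)).trans htot
  have hPval : ∀ x y, P (x, y) =
      (1 - A) * P0 (x, y) + ∑ j, α j * (if ystar j = y then R j x else 0) := by
    intro x y
    simp only [hP, pushforward_featureLabel, hR]
  have hPmarg : ∀ x, margX P x = (1 - A) * margX P0 x + ∑ j, α j * R j x := by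
    intro x
    simp only [margX, hPval, Finset.sum_add_distrib, ← Finset.mul_sum]
    rw [Finset.sum_comm]
    simp
  have hΔx : ∀ c, ∀ x ∈ Finset.univ.image (g c), ∀ y,
      P0 (x, y) - P0 (x, ystar c) ≤ Δ c * margX P0 x := by
    intro c x hx y
    have h1 : condY P0 x y - condY P0 x (ystar c) ≤ Δ c := by
      rw [hΔ c]
      refine le_trans ?_ (Finset.le_sup' _ hx)
      exact sub_le_sub_right (Finset.le_sup' (fun y => condY P0 x y) (Finset.mem_univ y)) _
    rwa [condY, condY, ← sub_div, div_le_iff₀ (hpos x)] at h1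
  have hΔ0 : ∀ c, 0 ≤ Δ c := by
    intro c
    obtain ⟨w⟩ := ‹Nonempty X›
    have h := hΔx c (g c w) (Finset.mem_image_of_mem _ (Finset.mem_univ w)) (ystar c)
    rw [sub_self] at h
    exact nonneg_of_mul_nonneg_left h (hpos _)
  have hξ' : ∀ c j, j ≠ c → ∑ x ∈ Finset.univ.image (g c), R j x ≤ ξ := by
    intro c j hj
    simpa only [margX_pushforward_featureLabel] using hξ c j hj
  set T : Fin M → Finset (Fin M) := fun c => Finset.univ.filter fun j => ystar j ≠ ystar c with hT
  have hTne : ∀ c, ∀ j ∈ T c, j ≠ c := by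
    rintro c j hj rfl
    simp [hT] at hj
  have hN : ∀ c, A - α c - β c = ∑ j ∈ T c, α j := by
    intro c
    have h1 : A = ∑ j ∈ Finset.univ.filter (fun j => ystar j = ystar c), α j + ∑ j ∈ T c, α j :=
      (Finset.sum_filter_add_sum_filter_not _ _ _).symm
    have h2 : Finset.univ.filter (fun j => ystar j = ystar c) =
        insert c (Finset.univ.filter fun j => j ≠ c ∧ ystar j = ystar c) := by
      ext j
      by_cases h : j = c <;> simp [h]
    rw [h2, Finset.sum_insert (by simp), ← hβ c] at h1
    linarith
  -- the pointwise inequality at a misclassified signal point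
  have hpt : ∀ c, ∀ x ∈ (Finset.univ.image (g c)).filter (fun x => m x ≠ ystar c),
      α c * (1 - 2 * ε) * R c x ≤ (1 - A) * (Δ c + 2 * ε) * margX P0 x
        + (1 + 2 * ε) * ∑ j ∈ T c, α j * R j x := by
    intro c x hx
    obtain ⟨hxi, hm⟩ := Finset.mem_filter.mp hx
    have hRc : 0 < R c x := by
      obtain ⟨w, -, rfl⟩ := Finset.mem_image.mp hxi
      refine lt_of_lt_of_le (hpos w) ?_
      have h := Finset.single_le_sum
        (f := fun v => if g c v = g c w then margX P0 v else 0)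
        (fun v _ => by split_ifs <;> simp [hP0nn]) (Finset.mem_univ w)
      simpa [hR, featureMass] using h
    have hterm : ∀ j, 0 ≤ α j * R j x := fun j => mul_nonneg (hα j).le (hRnn j x)
    have hPpos : 0 < margX P x := by
      rw [hPmarg]
      have h1 : α c * R c x ≤ ∑ j, α j * R j x :=
        Finset.single_le_sum (fun j _ => hterm j) (Finset.mem_univ c)
      have h2 := mul_pos (hα c) hRc
      have h3 := mul_nonneg (sub_nonneg.mpr htot) (hP0nn x)
      linarith
    have hs := hsub.sub_le (Set.mem_univ x) hPpos (ystar c)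
    rw [hPval, hPval, hPmarg] at hs
    have hsplit : ∑ j, α j * R j x =
        ∑ j, α j * (if ystar j = ystar c then R j x else 0) + ∑ j ∈ T c, α j * R j x := by
      rw [hT, Finset.sum_filter, ← Finset.sum_add_distrib]
      refine Finset.sum_congr rfl fun j _ => ?_
      by_cases h : ystar j = ystar c <;> simp [h]
    have hlow : α c * R c x ≤ ∑ j, α j * (if ystar j = ystar c then R j x else 0) := by
      have h := Finset.single_le_sum
        (f := fun j => α j * (if ystar j = ystar c then R j x else 0))
        (fun j _ => by split_ifs <;> simp [hterm]) (Finset.mem_univ c)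
      simpa using h
    have hup : ∑ j, α j * (if ystar j = m x then R j x else 0) ≤ ∑ j ∈ T c, α j * R j x := by
      rw [hT, Finset.sum_filter]
      refine Finset.sum_le_sum fun j _ => ?_
      by_cases h : ystar j = m x
      · simp [h, hm]
      · rw [if_neg h, mul_zero]
        split_ifs <;> simp [hterm]
    have hd := mul_le_mul_of_nonneg_left (hΔx c x hxi (m x)) (sub_nonneg.mpr htot)
    have hl := mul_le_mul_of_nonneg_left hlow hK.le
    rw [hsplit] at hs
    linarith
  set B : Fin M → ℝ := fun c => ∑ x, if m (g c x) ≠ ystar c then margX P0 x else 0 with hB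
  have hS : ∀ c, ∑ x, margX P0 x * (if m (g c x) = ystar c then (1 : ℝ) else 0) = 1 - B c := by
    intro c
    rw [eq_sub_iff_add_eq, hB, ← Finset.sum_add_distrib]
    refine Eq.trans ?_ hsum1
    refine Finset.sum_congr rfl fun x _ => ?_
    by_cases h : m (g c x) = ystar c <;> simp [h]
  -- the failure bound for each collective
  have hfail : ∀ c, α c * (1 - 2 * ε) * B c ≤ (1 - A) * (Δ c + 2 * ε) * ξc c
      + (1 + 2 * ε) * (ξ * ∑ j ∈ T c, α j) := by
    intro c
    have hsum := Finset.sum_le_sum (hpt c)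
    have hBc : ∑ x ∈ (Finset.univ.image (g c)).filter (fun x => m x ≠ ystar c), R c x = B c :=
      sum_featureMass_filter_image P0 (g c) _
    rw [← Finset.mul_sum, hBc, Finset.sum_add_distrib, ← Finset.mul_sum, ← Finset.mul_sum,
      Finset.sum_comm] at hsum
    refine hsum.trans (add_le_add ?_ ?_)
    · refine mul_le_mul_of_nonneg_left (le_trans ?_ (hξc c))
        (mul_nonneg (sub_nonneg.mpr htot) (by linarith [hΔ0 c]))
      exact Finset.sum_le_sum_of_subset_of_nonneg (Finset.filter_subset _ _) fun x _ _ => hP0nn x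
    · refine mul_le_mul_of_nonneg_left ?_ (by linarith)
      rw [Finset.mul_sum]
      refine Finset.sum_le_sum fun j hj => ?_
      rw [← Finset.mul_sum, mul_comm ξ]
      refine mul_le_mul_of_nonneg_left (le_trans ?_ (hξ' c j (hTne c j hj))) (hα j).le
      exact Finset.sum_le_sum_of_subset_of_nonneg (Finset.filter_subset _ _)
        fun x _ _ => hRnn j x
  have hweighted : ∀ c, α c * B c ≤ (1 - A) * (ξc c * ((Δ c + 2 * ε) / (α c * (1 - 2 * ε))))
      + ξ * ((1 + 2 * ε) / (1 - 2 * ε)) * ((A - α c - β c) / α c) := by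
    intro c
    have hξc0 : 0 ≤ ξc c := (Finset.sum_nonneg fun x _ => hP0nn x).trans (hξc c)
    have hN0 : 0 ≤ ξ * ∑ j ∈ T c, α j := by
      rw [Finset.mul_sum]
      refine Finset.sum_nonneg fun j hj => mul_nonneg ?_ (hα j).le
      exact (Finset.sum_nonneg fun x _ => hRnn j x).trans (hξ' c j (hTne c j hj))
    have hrhs0 : 0 ≤ (1 - A) * (Δ c + 2 * ε) * ξc c + (1 + 2 * ε) * (ξ * ∑ j ∈ T c, α j) :=
      add_nonneg (mul_nonneg (mul_nonneg (sub_nonneg.mpr htot) (by linarith [hΔ0 c])) hξc0)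
        (mul_nonneg (by linarith) hN0)
    have hαc := hα c
    have heq : (1 - A) * (ξc c * ((Δ c + 2 * ε) / (α c * (1 - 2 * ε))))
        + ξ * ((1 + 2 * ε) / (1 - 2 * ε)) * ((A - α c - β c) / α c) =
        ((1 - A) * (Δ c + 2 * ε) * ξc c + (1 + 2 * ε) * (ξ * ∑ j ∈ T c, α j))
          / (α c * (1 - 2 * ε)) := by
      rw [hN]
      field_simp
    rw [heq, le_div_iff₀ (mul_pos hαc hK)]
    calc α c * B c * (α c * (1 - 2 * ε)) = α c * (α c * (1 - 2 * ε) * B c) := by ring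
      _ ≤ α c * _ := mul_le_mul_of_nonneg_left (hfail c) hαc.le
      _ ≤ _ := mul_le_of_le_one_left hrhs0 (hα1 c)
  have htotal := Finset.sum_le_sum fun c (_ : c ∈ Finset.univ) => hweighted c
  rw [Finset.sum_add_distrib, ← Finset.mul_sum, ← Finset.mul_sum] at htotal
  have hsuccess : ∑ c, α c * ∑ x, margX P0 x * (if m (g c x) = ystar c then (1 : ℝ) else 0)
      = A - ∑ c, α c * B c := by
    simp only [hS, mul_sub, mul_one, Finset.sum_sub_distrib, hA]
  rw [hsuccess]
  generalize (∑ c, ξc c * ((Δ c + 2 * ε) / (α c * (1 - 2 * ε)))) = U at htotal ⊢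
  generalize (∑ c, (A - α c - β c) / α c) = V at htotal ⊢
  generalize (1 + 2 * ε) / (1 - 2 * ε) = W at htotal ⊢
  have hlhs : 1 - (1 - A) / A * U - ξ * W * (1 / A) * V =
      1 / A * (A - ((1 - A) * U + ξ * W * V)) := by
    field_simp
    ring
  rw [hlhs]
  exact mul_le_mul_of_nonneg_left (by linarith) (by positivity)
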